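/- arXiv:2006.12947 — 3 statements merged into one kernel-verified Lean document; each statement's English description precedes it below -/
import Mathlib

section
/- Let R be a commutative ring, n ≥ 1, and ε ∈ R with ε² = 0. Let τ, A ∈ R, let B be a 1×n matrix, C an n×1 matrix, D an n×n matrix, E an n×1 matrix over R, and let S be an invertible n×n matrix over R. Define the (1+n)×(1+n) block matrices L = [[ε(−τ + A + B·S·E), ε·B·(I − S)], [S·E + ε(C + D·S·E), −S + ε(−τ·I + D·(I − S))]] and K = [[1, ε·B·(I − S)·S⁻¹], [0, I]]. Then K·L = [[ε(−τ + A + B·E), 0], [S·E + ε(C + D·S·E), −S + ε(−τ·I + D·(I − S))]]. In particular the top-right block of K·L vanishes identically. -/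
open Matrix

/-- When `ε ^ 2 = 0`, multiplying by `ε • X` only sees the zeroth-order part of the other factor. -/
theorem smul_mul_add_smul_of_sq_eq_zero {R l m n : Type*} [CommRing R] [Fintype m]
    {ε : R} (hε : ε ^ 2 = 0) (X : Matrix l m R) (Y Z : Matrix m n R) :
    (ε • X) * (Y + ε • Z) = ε • (X * Y) := by
  rw [Matrix.mul_add, Matrix.smul_mul, Matrix.smul_mul, Matrix.mul_smul, smul_smul, ← sq, hε,
    zero_smul, add_zero]

/-- Gaussian elimination step in the dispersion-equation analysis of a
multiple-relaxation-time lattice Boltzmann scheme with one conserved moment and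
`n` non-conserved moments, at first order in `ε = Δt` (so `ε² = 0`):
left multiplication by `K = [[1, ε·B·(I−S)·S⁻¹],[0, I]]` kills the top-right
block of `L` and replaces the top-left block by `ε(−τ + A + B·E)`. -/
theorem dispersion_gaussian_elimination
    {R : Type*} [CommRing R] (n : ℕ) (hn : 1 ≤ n) (ε τ A : R) (hε : ε ^ 2 = 0)
    (B : Matrix (Fin 1) (Fin n) R) (C : Matrix (Fin n) (Fin 1) R)
    (D : Matrix (Fin n) (Fin n) R) (E : Matrix (Fin n) (Fin 1) R)
    (S : Matrix (Fin n) (Fin n) R) [Invertible S] :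
    (Matrix.fromBlocks
        (1 : Matrix (Fin 1) (Fin 1) R) (ε • (B * (1 - S) * S⁻¹))
        (0 : Matrix (Fin n) (Fin 1) R) (1 : Matrix (Fin n) (Fin n) R)) *
      (Matrix.fromBlocks
        (ε • ((-τ + A) • (1 : Matrix (Fin 1) (Fin 1) R) + B * S * E))
        (ε • (B * (1 - S)))
        (S * E + ε • (C + D * S * E))
        (-S + ε • ((-τ) • (1 : Matrix (Fin n) (Fin n) R) + D * (1 - S)))) =
    Matrix.fromBlocks
        (ε • ((-τ + A) • (1 : Matrix (Fin 1) (Fin 1) R) + B * E))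
        (0 : Matrix (Fin 1) (Fin n) R)
        (S * E + ε • (C + D * S * E))
        (-S + ε • ((-τ) • (1 : Matrix (Fin n) (Fin n) R) + D * (1 - S))) := by
  have hS : B * (1 - S) * S⁻¹ * S = B * (1 - S) := by
    rw [Matrix.mul_assoc, Matrix.inv_mul_of_invertible, Matrix.mul_one]
  rw [Matrix.fromBlocks_multiply]
  simp only [smul_mul_add_smul_of_sq_eq_zero hε, Matrix.one_mul, Matrix.zero_mul, zero_add,
    Matrix.mul_neg, hS, smul_neg, add_neg_cancel]
  congr 1
  rw [← Matrix.mul_assoc, hS, Matrix.mul_sub, Matrix.mul_one, Matrix.sub_mul, ← smul_add]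
  congr 1
  abel
end

section
/- Let R be a commutative ring, n ≥ 1, and ε ∈ R with ε² = 0. Let τ, A ∈ R, let B be a 1×n matrix, C an n×1 matrix, D an n×n matrix, E an n×1 matrix over R, and let S be an invertible n×n matrix over R. Define L = [[ε(−τ + A + B·S·E), ε·B·(I − S)], [S·E + ε(C + D·S·E), −S + ε(−τ·I + D·(I − S))]]. Then det L = ε(−τ + A + B·E) · det(−S + ε(−τ·I + D·(I − S))). -/
open Matrix

/-- Factorization of the dispersion determinant for a multiple-relaxation-time
lattice Boltzmann scheme with one conserved moment and `n` non-conserved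
moments, at first order in `ε = Δt` (so `ε² = 0`):
`det L = ε(−τ + A + B·E) · det(−S + ε(−τ·I + D·(I − S)))`. -/
theorem dispersion_determinant_factorization
    {R : Type*} [CommRing R] (n : ℕ) (hn : 1 ≤ n) (ε τ A : R) (hε : ε ^ 2 = 0)
    (B : Matrix (Fin 1) (Fin n) R) (C : Matrix (Fin n) (Fin 1) R)
    (D : Matrix (Fin n) (Fin n) R) (E : Matrix (Fin n) (Fin 1) R)
    (S : Matrix (Fin n) (Fin n) R) [Invertible S] :
    (Matrix.fromBlocks
        (ε • ((-τ + A) • (1 : Matrix (Fin 1) (Fin 1) R) + B * S * E))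
        (ε • (B * (1 - S)))
        (S * E + ε • (C + D * S * E))
        (-S + ε • ((-τ) • (1 : Matrix (Fin n) (Fin n) R) + D * (1 - S)))).det =
    ε * (-τ + A + (B * E) 0 0) *
      (-S + ε • ((-τ) • (1 : Matrix (Fin n) (Fin n) R) + D * (1 - S))).det := by
  have hεε : ε * ε = 0 := by rw [← sq, hε]
  have eliminate (m : Type) (Y Z : Matrix (Fin n) m R) :
      (ε • (B * (1 - S) * ⅟S)) * (S * Y + ε • Z) = ε • (B * (1 - S) * Y) := by
    rw [Matrix.mul_add, Matrix.smul_mul, Matrix.smul_mul, Matrix.mul_smul, smul_smul, hεε,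
      zero_smul, add_zero, Matrix.mul_assoc (B * (1 - S)), Matrix.invOf_mul_cancel_left]
  have top_left : ε • ((-τ + A) • (1 : Matrix (Fin 1) (Fin 1) R) + B * S * E) +
      (ε • (B * (1 - S) * ⅟S)) * (S * E + ε • (C + D * S * E)) =
      ε • ((-τ + A) • (1 : Matrix (Fin 1) (Fin 1) R) + B * E) := by
    rw [eliminate, ← smul_add, Matrix.mul_sub, Matrix.sub_mul, Matrix.mul_one]
    congr 1
    abel
  have top_right : ε • (B * (1 - S)) + (ε • (B * (1 - S) * ⅟S)) *
      (-S + ε • ((-τ) • (1 : Matrix (Fin n) (Fin n) R) + D * (1 - S))) = 0 := by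
    have h := eliminate (Fin n) (-1) ((-τ) • (1 : Matrix (Fin n) (Fin n) R) + D * (1 - S))
    rw [Matrix.mul_neg, Matrix.mul_one, Matrix.mul_neg, Matrix.mul_one] at h
    rw [h, smul_neg, add_neg_cancel]
  have det_K : (Matrix.fromBlocks (1 : Matrix (Fin 1) (Fin 1) R) (ε • (B * (1 - S) * ⅟S)) 0
      (1 : Matrix (Fin n) (Fin n) R)).det = 1 := by
    rw [Matrix.det_fromBlocks_zero₂₁, Matrix.det_one, Matrix.det_one, one_mul]
  rw [← one_mul (Matrix.det _), ← det_K, ← Matrix.det_mul, Matrix.fromBlocks_multiply]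
  simp only [Matrix.one_mul, Matrix.zero_mul, zero_add]
  rw [top_left, top_right, Matrix.det_fromBlocks_zero₁₂, Matrix.det_fin_one]
  simp
end

section
/- Let λ ∈ ℝ with λ ≠ 0, let α, β ∈ ℝ, and let a, b ∈ ℝ. Let G(a,b) = M · V(a,b) · M⁻¹ where V(a,b) is the 9×9 diagonal matrix with j-th diagonal entry λ·(e_j¹·a + e_j²·b), and let E_Z = (αλ², 0, 0, 0, 0, βλ⁴)ᵀ be the column of equilibrium coefficients of the truly relaxing moments (m₃,…,m₈) as linear functions of the density ρ. Then: (i) G(a,b)₀,₀ = 0 and Σ_{k=3}^{8} G(a,b)₀,ₖ · (E_Z)_{k−3} = 0; (ii) G(a,b)₀,₁ = a and G(a,b)₀,₂ = b; (iii) G(a,b)ᵢ,ⱼ = 0 for all i, j ∈ {1,2}; (iv) G(a,b)₁,₀ + Σ_{k=3}^{8} G(a,b)₁,ₖ · (E_Z)_{k−3} = (λ²(4+α)/6)·a and G(a,b)₂,₀ + Σ_{k=3}^{8} G(a,b)₂,ₖ · (E_Z)_{k−3} = (λ²(4+α)/6)·b. Consequently the first-order equivalent system of the scalar D2Q9 scheme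 with evanescent momentum relaxation is the damped acoustic system with sound speed c₀ given by c₀² = λ²(4+α)/6. -/
/-- First cartesian components of the D2Q9 velocities. -/
def d2q9e1 : Fin 9 → ℝ := ![0, 1, 0, -1, 0, 1, -1, -1, 1]

/-- Second cartesian components of the D2Q9 velocities. -/
def d2q9e2 : Fin 9 → ℝ := ![0, 0, 1, 0, -1, 1, 1, -1, -1]

/-- The 9×9 moment matrix of the D2Q9 lattice Boltzmann scheme. -/
def d2q9M (l : ℝ) : Matrix (Fin 9) (Fin 9) ℝ :=
  !![1, 1, 1, 1, 1, 1, 1, 1, 1;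
     0, l, 0, -l, 0, l, -l, -l, l;
     0, 0, l, 0, -l, l, l, -l, -l;
     -4*l^2, -l^2, -l^2, -l^2, -l^2, 2*l^2, 2*l^2, 2*l^2, 2*l^2;
     0, l^2, -l^2, l^2, -l^2, 0, 0, 0, 0;
     0, 0, 0, 0, 0, l^2, -l^2, l^2, -l^2;
     0, -2*l^3, 0, 2*l^3, 0, l^3, -l^3, -l^3, l^3;
     0, 0, -2*l^3, 0, 2*l^3, l^3, l^3, -l^3, -l^3;
     4*l^4, -2*l^4, -2*l^4, -2*l^4, -2*l^4, l^4, l^4, l^4, l^4]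

/-- The diagonal velocity matrix `V(a,b)` with scalars `a, b` substituted
for `∂x, ∂y`. -/
def d2q9V (l a b : ℝ) : Matrix (Fin 9) (Fin 9) ℝ :=
  Matrix.diagonal (fun j => l * (d2q9e1 j * a + d2q9e2 j * b))

/-- Symbolic momentum-velocity matrix `G(a,b) = M·V(a,b)·M⁻¹`
(so that `Λ = −G(∂x,∂y)`). -/
noncomputable def d2q9G (l a b : ℝ) : Matrix (Fin 9) (Fin 9) ℝ :=
  d2q9M l * d2q9V l a b * (d2q9M l)⁻¹

/-- The embedding of the indices of the truly relaxing moments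
`m₃,…,m₈` into `Fin 9`. -/
def shiftZ (k : Fin 6) : Fin 9 := ⟨k.1 + 3, by omega⟩

/-- The rows of the D2Q9 moment matrix are pairwise orthogonal. -/
theorem d2q9M_mul_transpose (l : ℝ) :
    d2q9M l * (d2q9M l).transpose = Matrix.diagonal
      ![9, 6 * l^2, 6 * l^2, 36 * l^4, 4 * l^4, 4 * l^4, 12 * l^6, 12 * l^6, 36 * l^8] := by
  ext i j
  fin_cases i <;> fin_cases j <;>
    simp [d2q9M, Matrix.mul_apply, Fin.sum_univ_succ] <;> ring

theorem isUnit_det_d2q9M {l : ℝ} (hl : l ≠ 0) : IsUnit (d2q9M l).det := by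
  have h := congrArg Matrix.det (d2q9M_mul_transpose l)
  rw [Matrix.det_mul, Matrix.det_diagonal] at h
  refine isUnit_of_mul_isUnit_left (y := (d2q9M l).transpose.det) ?_
  rw [h]
  simp [Fin.prod_univ_succ, hl]

/-- A row of `G(a,b)` is determined by expressing the same row of `M·V(a,b)` as a linear
combination of the rows of `M`. -/
theorem d2q9G_row_eq {l : ℝ} (hl : l ≠ 0) (a b : ℝ) (i : Fin 9) (w : Fin 9 → ℝ)
    (h : Matrix.vecMul w (d2q9M l) = (d2q9M l * d2q9V l a b) i) : d2q9G l a b i = w := by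
  rw [d2q9G, Matrix.mul_apply_eq_vecMul, ← h, Matrix.vecMul_vecMul,
    Matrix.mul_nonsing_inv _ (isUnit_det_d2q9M hl), Matrix.vecMul_one]

theorem d2q9G_zero {l : ℝ} (hl : l ≠ 0) (a b : ℝ) :
    d2q9G l a b 0 = ![0, a, b, 0, 0, 0, 0, 0, 0] := by
  refine d2q9G_row_eq hl a b 0 _ (funext fun j => ?_)
  fin_cases j <;>
    simp [d2q9M, d2q9V, d2q9e1, d2q9e2, Matrix.vecMul, dotProduct, Fin.sum_univ_succ] <;> ring

theorem d2q9G_one {l : ℝ} (hl : l ≠ 0) (a b : ℝ) :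
    d2q9G l a b 1 = ![2 * l^2 / 3 * a, 0, 0, a / 6, a / 2, b, 0, 0, 0] := by
  refine d2q9G_row_eq hl a b 1 _ (funext fun j => ?_)
  fin_cases j <;>
    simp [d2q9M, d2q9V, d2q9e1, d2q9e2, Matrix.vecMul, dotProduct, Fin.sum_univ_succ] <;> ring

theorem d2q9G_two {l : ℝ} (hl : l ≠ 0) (a b : ℝ) :
    d2q9G l a b 2 = ![2 * l^2 / 3 * b, 0, 0, b / 6, -b / 2, a, 0, 0, 0] := by
  refine d2q9G_row_eq hl a b 2 _ (funext fun j => ?_)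
  fin_cases j <;>
    simp [d2q9M, d2q9V, d2q9e1, d2q9e2, Matrix.vecMul, dotProduct, Fin.sum_univ_succ] <;> ring

/-- The damped-acoustic structure of the first-order equivalent system of the
scalar D2Q9 scheme with evanescent momentum relaxation: with
`E_Z = (αλ², 0, 0, 0, 0, βλ⁴)ᵀ` the equilibrium coefficients of the truly
relaxing moments, (i) `G₀₀ = 0` and `Σₖ G₀ₖ (E_Z)ₖ = 0`; (ii) `G₀₁ = a`,
`G₀₂ = b`; (iii) `Gᵢⱼ = 0` for `i,j ∈ {1,2}`; (iv) the closure of the momentum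
equations produces the sound speed `c₀² = λ²(4+α)/6`. -/
theorem d2q9_damped_acoustic_structure (l : ℝ) (hl : l ≠ 0) (α β a b : ℝ) :
    let EZ : Fin 6 → ℝ := ![α * l^2, 0, 0, 0, 0, β * l^4]
    (d2q9G l a b 0 0 = 0 ∧ ∑ k : Fin 6, d2q9G l a b 0 (shiftZ k) * EZ k = 0) ∧
    (d2q9G l a b 0 1 = a ∧ d2q9G l a b 0 2 = b) ∧
    (∀ i j : Fin 9, i ∈ ({1, 2} : Set (Fin 9)) → j ∈ ({1, 2} : Set (Fin 9)) →
      d2q9G l a b i j = 0) ∧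
    (d2q9G l a b 1 0 + ∑ k : Fin 6, d2q9G l a b 1 (shiftZ k) * EZ k
        = l^2 * (4 + α) / 6 * a ∧
      d2q9G l a b 2 0 + ∑ k : Fin 6, d2q9G l a b 2 (shiftZ k) * EZ k
        = l^2 * (4 + α) / 6 * b) := by
  intro EZ
  refine ⟨⟨?_, ?_⟩, ⟨?_, ?_⟩, ?_, ?_, ?_⟩
  · simp [d2q9G_zero hl]
  · simp [d2q9G_zero hl, Fin.sum_univ_succ, shiftZ, EZ]
  · simp [d2q9G_zero hl]
  · simp [d2q9G_zero hl]
  · rintro i j (rfl | rfl) (rfl | rfl) <;> simp [d2q9G_one hl, d2q9G_two hl]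
  · simp [d2q9G_one hl, Fin.sum_univ_succ, shiftZ, EZ]
    ring
  · simp [d2q9G_two hl, Fin.sum_univ_succ, shiftZ, EZ]
    ring
end
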